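/- For all real numbers d_i > 1, c_i > 0, d_u ≥ 1, c_u > 0 there exists a constant c_4 > 0, depending only on d_i, c_i, d_u, c_u, with the following property. Let G = (V,E) be a graph satisfying the local isoperimetric inequality L(d_i,c_i) and the volume upper bound V_u(d_u,c_u); fix γ > 1 and set L_0 = 10000, L_{k+1} = L_k^γ. Let x ∈ V, let k ≥ 1 be such that 2000·L_k < L_{k+1}, let ω : V → {0,1} be a configuration for which the separation event S(x, L_{k+1}) occurs, and let K ⊆ B(x, 5L_{k+1}/6) be a set with B(x, 4L_{k+1}/6) ⊆ B(K, L_k/6). Then, setting N = ⌊c_4 · L_k^{γ(d_i−1)/d_i − (d_u−1)}⌋, there exist points y_1, …, y_N ∈ K such that d(y_j, y_{j'}) ≥ 3 L_k for all 1 ≤ j < j' ≤ N and the separation event S(y_j, L_k) occurs for every j = 1, …, N. -/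

import Mathlib

open MeasureTheory Filter

universe u

variable {V : Type u}

/-- The set of vertices within graph distance `r` of `x`. -/
def gball (G : SimpleGraph V) (x : V) (r : ℝ) : Set V :=
  {y | ∃ p : G.Walk x y, (p.length : ℝ) ≤ r}

/-- The `r`-neighborhood `B(K, r)` of a set `K`. -/
def gnbhd (G : SimpleGraph V) (K : Set V) (r : ℝ) : Set V :=
  {y | ∃ x ∈ K, y ∈ gball G x r}

/-- The edge boundary of `A` relative to `B`, encoded as ordered pairs
`(a, b)` with `a ∈ A`, `b ∈ B \ A` and `a ~ b`. -/
def relBoundary (G : SimpleGraph V) (A B : Set V) : Set (V × V) :=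
  {e | G.Adj e.1 e.2 ∧ e.1 ∈ A ∧ e.2 ∈ B ∧ e.2 ∉ A}

/-- The edge boundary of `A`, encoded as ordered pairs `(a, b)` with
`a ∈ A`, `b ∉ A` and `a ~ b`. -/
def bdry (G : SimpleGraph V) (A : Set V) : Set (V × V) :=
  {e | G.Adj e.1 e.2 ∧ e.1 ∈ A ∧ e.2 ∉ A}

/-- The local isoperimetric inequality `L(dᵢ, cᵢ)`. -/
def LocalIso (G : SimpleGraph V) (di ci : ℝ) : Prop :=
  ∀ (x : V) (r : ℝ), 1 ≤ r → ∀ A : Set V, A ⊆ gball G x r →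
    (A.ncard : ℝ) ≤ (gball G x r).ncard / 2 →
    ci * (A.ncard : ℝ) ^ ((di - 1) / di) ≤ ((relBoundary G A (gball G x r)).ncard : ℝ)

/-- The volume upper bound `𝒱ᵤ(dᵤ, cᵤ)`. -/
def VolUpper (G : SimpleGraph V) (du cu : ℝ) : Prop :=
  ∀ (x : V) (r : ℝ), 1 ≤ r →
    (gball G x r).Finite ∧ ((gball G x r).ncard : ℝ) ≤ cu * r ^ du

/-- The volume lower bound `𝒱ₗ(dₗ, cₗ)`. -/
def VolLower (G : SimpleGraph V) (dl cl : ℝ) : Prop :=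
  ∀ (x : V) (r : ℝ), 1 ≤ r → cl * r ^ dl ≤ ((gball G x r).ncard : ℝ)

/-- Every walk from `y` to `z` has length at least `t`; equivalently the graph
distance from `y` to `z` (with value `∞` if unreachable) is at least `t`. -/
def distGE (G : SimpleGraph V) (y z : V) (t : ℝ) : Prop :=
  ∀ p : G.Walk y z, t ≤ (p.length : ℝ)

/-- The distance between the sets `A` and `B` is at least `t`. -/
def setDistGE (G : SimpleGraph V) (A B : Set V) (t : ℝ) : Prop :=
  ∀ a ∈ A, ∀ b ∈ B, distGE G a b t

/-- The diameter of `A` is at least `t`. -/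
def diamGE (G : SimpleGraph V) (A : Set V) (t : ℝ) : Prop :=
  ∃ y ∈ A, ∃ z ∈ A, distGE G y z t

/-- The diameter of `A` is at most `t`. -/
def diamLE (G : SimpleGraph V) (A : Set V) (t : ℝ) : Prop :=
  ∀ y ∈ A, ∀ z ∈ A, ∃ p : G.Walk y z, (p.length : ℝ) ≤ t

/-- `A` is a connected set of vertices. -/
def ConnSet (G : SimpleGraph V) (A : Set V) : Prop := (G.induce A).Connected

/-- There is an open path, all of whose vertices lie in `S`, connecting `A` to `A'`:
its first vertex lies in `B(A,1)` and its last vertex in `B(A',1)`. -/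
def ConnectsIn (G : SimpleGraph V) (ω : V → Bool) (A A' S : Set V) : Prop :=
  ∃ (a b : V) (p : G.Walk a b), a ∈ gnbhd G A 1 ∧ b ∈ gnbhd G A' 1 ∧
    (∀ v ∈ p.support, v ∈ S) ∧ (∀ v ∈ p.support, ω v = true)

/-- The separation event `𝒮(x, L)`. -/
def sep (G : SimpleGraph V) (ω : V → Bool) (x : V) (L : ℝ) : Prop :=
  ∃ A B : Set V, A ⊆ gball G x (3 * L / 6) ∧ B ⊆ gball G x (3 * L / 6) ∧
    ConnSet G A ∧ ConnSet G B ∧ setDistGE G A B 2 ∧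
    diamGE G A (L / 100) ∧ diamGE G B (L / 100) ∧
    ¬ ConnectsIn G ω A B (gball G x L)

/-- The open cluster `𝒞ₓ` of `x` (empty when `x` is closed). -/
def openCluster (G : SimpleGraph V) (ω : V → Bool) (x : V) : Set V :=
  {y | ω x = true ∧ ∃ p : G.Walk x y, ∀ v ∈ p.support, ω v = true}

/-- There is exactly one infinite open cluster. -/
def UniqueInfCluster (G : SimpleGraph V) (ω : V → Bool) : Prop :=
  (∃ x, (openCluster G ω x).Infinite) ∧
    ∀ x y, (openCluster G ω x).Infinite → (openCluster G ω y).Infinite →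
      openCluster G ω x = openCluster G ω y

/-- `P` is the Bernoulli product measure on `{0,1}^V` with parameter `p`, characterized by
its values on cylinder events. -/
def IsBernoulli (P : Measure (V → Bool)) (p : ℝ) : Prop :=
  ∀ (F : Finset V) (η : V → Bool),
    P {ω | ∀ x ∈ F, ω x = η x} =
      ENNReal.ofReal (p ^ (F.filter fun x => η x = true).card *
        (1 - p) ^ (F.filter fun x => η x = false).card)

/-- A decreasing event. -/
def DecreasingEvent (E : Set (V → Bool)) : Prop :=
  ∀ ω ∈ E, ∀ ω' : V → Bool, (∀ x, ω' x ≤ ω x) → ω' ∈ E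

/-- The σ-algebra `σ(Y_z ; z ∈ S)` generated by the coordinates in `S`. -/
def cylσ (S : Set V) : MeasurableSpace (V → Bool) :=
  MeasurableSpace.comap (fun ω => S.restrict ω) MeasurableSpace.pi

/-- The decoupling inequality `𝒟(α, c_α)`. -/
def Decoupling (G : SimpleGraph V) (P : Measure (V → Bool)) (α cα : ℝ) : Prop :=
  ∀ (x : V) (r : ℝ), 1 ≤ r → ∀ E E' : Set (V → Bool),
    DecreasingEvent E → DecreasingEvent E' →
    MeasurableSet[cylσ (gball G x r)] E →
    MeasurableSet[cylσ (gball G x (2 * r))ᶜ] E' →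
    P (E ∩ E') ≤ P E * P E' + ENNReal.ofReal (cα * r ^ (-α))

/-- The scales `L₀ = 10000`, `L_{k+1} = L_k ^ γ`. -/
noncomputable def Lseq (γ : ℝ) : ℕ → ℝ
  | 0 => 10000
  | k + 1 => Lseq γ k ^ γ

lemma gball_self (G : SimpleGraph V) (x : V) {r : ℝ} (h : 0 ≤ r) : x ∈ gball G x r :=
  ⟨SimpleGraph.Walk.nil, by simpa using h⟩

lemma gball_mono {G : SimpleGraph V} {x y : V} {r s : ℝ} (h : r ≤ s) (hy : y ∈ gball G x r) :
    y ∈ gball G x s := by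
  obtain ⟨p, hp⟩ := hy
  exact ⟨p, hp.trans h⟩

lemma gball_symm {G : SimpleGraph V} {x y : V} {r : ℝ} (hy : y ∈ gball G x r) :
    x ∈ gball G y r := by
  obtain ⟨p, hp⟩ := hy
  exact ⟨p.reverse, by simpa using hp⟩

lemma gball_trans {G : SimpleGraph V} {x y z : V} {r s : ℝ} (hy : y ∈ gball G x r)
    (hz : z ∈ gball G y s) : z ∈ gball G x (r + s) := by
  obtain ⟨p, hp⟩ := hy
  obtain ⟨q, hq⟩ := hz
  exact ⟨p.append q, by rw [SimpleGraph.Walk.length_append]; push_cast; linarith⟩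

lemma gball_adj {G : SimpleGraph V} {x y : V} (h : G.Adj x y) : y ∈ gball G x 1 :=
  ⟨SimpleGraph.Walk.cons h SimpleGraph.Walk.nil, by simp⟩

lemma gball_of_not_distGE {G : SimpleGraph V} {x y : V} {t : ℝ} (h : ¬ distGE G x y t) :
    y ∈ gball G x t := by
  unfold distGE at h
  push Not at h
  obtain ⟨p, hp⟩ := h
  exact ⟨p, hp.le⟩

lemma distGE_split {G : SimpleGraph V} {u v : V} {t : ℝ} (h : distGE G u v t) (w : V) :
    distGE G w u (t / 2) ∨ distGE G w v (t / 2) := by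
  by_contra hc
  unfold distGE at hc
  push Not at hc
  obtain ⟨⟨p, hp⟩, ⟨q, hq⟩⟩ := hc
  have := h (p.reverse.append q)
  rw [SimpleGraph.Walk.length_append, SimpleGraph.Walk.length_reverse] at this
  push_cast at this
  linarith

lemma distGE_mono {G : SimpleGraph V} {u v : V} {s t : ℝ} (h : distGE G u v t) (hs : s ≤ t) :
    distGE G u v s := fun p => hs.trans (h p)

def WalkIn (G : SimpleGraph V) (S : Set V) (u v : V) : Prop :=
  ∃ p : G.Walk u v, ∀ x ∈ p.support, x ∈ S

lemma WalkIn.refl {G : SimpleGraph V} {S : Set V} {u : V} (h : u ∈ S) : WalkIn G S u u :=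
  ⟨SimpleGraph.Walk.nil, by simpa using h⟩

lemma WalkIn.trans {G : SimpleGraph V} {S : Set V} {u v w : V} (h : WalkIn G S u v)
    (h' : WalkIn G S v w) : WalkIn G S u w := by
  obtain ⟨p, hp⟩ := h
  obtain ⟨q, hq⟩ := h'
  refine ⟨p.append q, fun x hx => ?_⟩
  rw [SimpleGraph.Walk.mem_support_append_iff] at hx
  exact hx.elim (hp x) (hq x)

lemma WalkIn.symm {G : SimpleGraph V} {S : Set V} {u v : V} (h : WalkIn G S u v) :
    WalkIn G S v u := by
  obtain ⟨p, hp⟩ := h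
  exact ⟨p.reverse, fun x hx => hp x (by simpa using hx)⟩

lemma WalkIn.mono {G : SimpleGraph V} {S T : Set V} {u v : V} (h : WalkIn G S u v)
    (hST : S ⊆ T) : WalkIn G T u v := by
  obtain ⟨p, hp⟩ := h
  exact ⟨p, fun x hx => hST (hp x hx)⟩

lemma WalkIn.right {G : SimpleGraph V} {S : Set V} {u v : V} (h : WalkIn G S u v) : v ∈ S := by
  obtain ⟨p, hp⟩ := h
  exact hp _ p.end_mem_support

lemma WalkIn.left {G : SimpleGraph V} {S : Set V} {u v : V} (h : WalkIn G S u v) : u ∈ S :=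
  h.symm.right

lemma WalkIn.adj {G : SimpleGraph V} {S : Set V} {u v : V} (h : G.Adj u v) (hu : u ∈ S)
    (hv : v ∈ S) : WalkIn G S u v := by
  refine ⟨SimpleGraph.Walk.cons h SimpleGraph.Walk.nil, fun x hx => ?_⟩
  simp at hx
  rcases hx with rfl | rfl <;> assumption

lemma WalkIn.ball_one {G : SimpleGraph V} {S : Set V} {u v : V} (h : v ∈ gball G u 1) (hu : u ∈ S)
    (hv : v ∈ S) : WalkIn G S u v := by
  obtain ⟨p, hp⟩ := h
  have hp' : p.length ≤ 1 := by exact_mod_cast hp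
  cases p with
  | nil => exact WalkIn.refl hu
  | cons h q =>
    cases q with
    | nil => exact WalkIn.adj h hu hv
    | cons h' q' => simp at hp'

/-- A walk in `S` stays in the set of points reachable in `S`. -/
lemma WalkIn.self {G : SimpleGraph V} {S : Set V} {u v : V} (h : WalkIn G S u v) :
    WalkIn G {z | WalkIn G S u z} u v := by
  classical
  obtain ⟨p, hp⟩ := h
  refine ⟨p, fun x hx => ⟨p.takeUntil x hx, fun y hy => hp y ?_⟩⟩
  exact p.support_takeUntil_subset_support hx hy

lemma connSet_of_walkIn {G : SimpleGraph V} {C : Set V} {w : V} (hw : w ∈ C)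
    (h : ∀ v ∈ C, WalkIn G C w v) : ConnSet G C := by
  refine SimpleGraph.induce_connected_of_patches w hw fun {v} hv => ?_
  obtain ⟨p, hp⟩ := h v hv
  refine ⟨{z | z ∈ p.support}, hp, p.start_mem_support, p.end_mem_support, ?_⟩
  exact p.connected_induce_support.preconnected _ _

lemma ConnSet.walkIn {G : SimpleGraph V} {C : Set V} (h : ConnSet G C) {u v : V} (hu : u ∈ C)
    (hv : v ∈ C) : WalkIn G C u v := by
  obtain ⟨p⟩ := h.preconnected ⟨u, hu⟩ ⟨v, hv⟩
  obtain ⟨q, hq⟩ : ∃ q : G.Walk u v, q.support = p.support.map (fun a => a.1) :=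
    ⟨p.map (SimpleGraph.Embedding.induce C).toHom, SimpleGraph.Walk.support_map _ _⟩
  refine ⟨q, fun x hx => ?_⟩
  rw [hq, List.mem_map] at hx
  obtain ⟨a, _, rfl⟩ := hx
  exact a.2

lemma ConnSet.le_ncard {G : SimpleGraph V} {C : Set V} (h : ConnSet G C) (hf : C.Finite) {u v : V}
    (hu : u ∈ C) (hv : v ∈ C) {t : ℝ} (ht : distGE G u v t) : t ≤ C.ncard := by
  classical
  obtain ⟨p, hp⟩ := h.preconnected.exists_isPath ⟨u, hu⟩ ⟨v, hv⟩
  have : Fintype C := hf.fintype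
  have h1 := hp.length_lt
  obtain ⟨q, hq⟩ : ∃ q : G.Walk u v, q.length = p.length :=
    ⟨p.map (SimpleGraph.Embedding.induce C).toHom, SimpleGraph.Walk.length_map _ _⟩
  have h2 := ht q
  rw [hq] at h2
  have h3 : C.ncard = Fintype.card C := by
    rw [← Nat.card_coe_set_eq, Nat.card_eq_fintype_card]
  rw [h3]
  have h4 : (p.length : ℝ) < Fintype.card C := by exact_mod_cast h1
  linarith

lemma exists_piece {G : SimpleGraph V} {S : Set V} {w u : V} {t : ℝ} (ht : 0 ≤ t)
    (h : WalkIn G S w u) (hd : distGE G w u t) :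
    ∃ C : Set V, C ⊆ S ∧ w ∈ C ∧ C ⊆ gball G w (t + 1) ∧ ConnSet G C ∧
      ∃ v ∈ C, distGE G w v t := by
  have hw : WalkIn G (S ∩ gball G w (t + 1)) w w :=
    WalkIn.refl ⟨h.left, gball_self G w (by linarith)⟩
  refine ⟨{v | WalkIn G (S ∩ gball G w (t + 1)) w v}, fun v hv => hv.right.1, hw,
    fun v hv => hv.right.2, connSet_of_walkIn hw fun v hv => WalkIn.self hv, ?_⟩
  by_contra hc
  push Not at hc
  have key : ∀ (a b : V) (p : G.Walk a b), (∀ x ∈ p.support, x ∈ S) →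
      WalkIn G (S ∩ gball G w (t + 1)) w a → WalkIn G (S ∩ gball G w (t + 1)) w b := by
    intro a b p
    induction p with
    | nil => exact fun _ h => h
    | cons hadj q ih =>
      intro hS ha
      refine ih (fun x hx => hS x (by simp [hx])) ?_
      refine ha.trans (WalkIn.adj hadj ha.right ⟨hS _ (by simp), ?_⟩)
      exact gball_trans (gball_of_not_distGE (hc _ ha)) (gball_adj hadj)
  obtain ⟨p, hp⟩ := h
  exact hc u (key w u p hp hw) hd

lemma gnbhd_finset_level {G : SimpleGraph V} {S : Set V} {u v : V} {r : ℝ} (h : G.Adj u v)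
    (hu : u ∈ gnbhd G S r) : v ∈ gnbhd G S (r + 1) := by
  obtain ⟨s, hs, hus⟩ := hu
  exact ⟨s, hs, gball_trans hus (gball_adj h)⟩

lemma gnbhd_mono {G : SimpleGraph V} {S : Set V} {u : V} {r s : ℝ} (h : r ≤ s)
    (hu : u ∈ gnbhd G S r) : u ∈ gnbhd G S s := by
  obtain ⟨a, hs, hus⟩ := hu
  exact ⟨a, hs, gball_mono h hus⟩

/-- The cluster of `A` in `X`, together with `A`. -/
def clus (G : SimpleGraph V) (ω : V → Bool) (A X : Set V) : Set V :=
  A ∪ {v | ∃ a ∈ gnbhd G A 1, WalkIn G (X ∩ {v | ω v = true}) a v}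

lemma clus_extend {G : SimpleGraph V} {ω : V → Bool} {A X : Set V} {w a b : V}
    (hw : w ∈ clus G ω A X) (ha : a ∈ gball G w 1) (h : WalkIn G (X ∩ {v | ω v = true}) a b) :
    b ∈ {v | ∃ a ∈ gnbhd G A 1, WalkIn G (X ∩ {v | ω v = true}) a v} := by
  rcases hw with hw | ⟨c, hc, hcw⟩
  · exact ⟨a, ⟨w, hw, ha⟩, h⟩
  · exact ⟨c, hc, (hcw.trans (WalkIn.ball_one ha hcw.right h.left)).trans h⟩

lemma clus_walk {G : SimpleGraph V} {ω : V → Bool} {A X : Set V} (hA : ConnSet G A) {w u : V}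
    (hw : w ∈ clus G ω A X) (hu : u ∈ A) : WalkIn G (clus G ω A X) w u := by
  rcases hw with hw | ⟨c, ⟨d, hd, hdc⟩, hcw⟩
  · exact (hA.walkIn hw hu).mono Set.subset_union_left
  · have h1 : WalkIn G (clus G ω A X) c w :=
      hcw.self.mono fun z hz => Or.inr ⟨c, ⟨d, hd, hdc⟩, hz⟩
    have h2 : WalkIn G (clus G ω A X) d c := WalkIn.ball_one hdc (Or.inl hd) h1.left
    exact (h2.trans h1).symm.trans ((hA.walkIn hd hu).mono Set.subset_union_left)

lemma sep_of {G : SimpleGraph V} {ω : V → Bool} {A X D : Set V} {y z w a₁ a₂ : V} {L r : ℝ}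
    (hL : 10000 ≤ L) (hA : ConnSet G A)
    (ha₁ : a₁ ∈ A) (ha₂ : a₂ ∈ A) (hd : distGE G a₁ a₂ (2 * L))
    (hw : w ∈ clus G ω A X) (hwz : w ∈ gball G z r) (hr : r ≤ L / 30)
    (hz : z ∈ gball G y (L / 6)) (hX : gball G y L ⊆ X)
    (hD : ConnSet G D) (hDy : D ⊆ gball G y (L / 2)) (hDd : diamGE G D (L / 100))
    (hsep : ∀ v ∈ clus G ω A X, v ∉ gnbhd G D 1) : sep G ω y L := by
  obtain ⟨u, hu, hwu⟩ : ∃ u ∈ A, distGE G w u (L / 100) := by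
    rcases distGE_split hd w with h | h
    · exact ⟨a₁, ha₁, distGE_mono h (by linarith)⟩
    · exact ⟨a₂, ha₂, distGE_mono h (by linarith)⟩
  obtain ⟨C, hCS, hwC, hCb, hCc, v, hv, hvd⟩ :=
    exists_piece (by linarith) (clus_walk hA hw hu) hwu
  refine ⟨C, D, fun c hc => ?_, fun d hd => gball_mono (by linarith) (hDy hd), hCc, hD, ?_,
    ⟨w, hwC, v, hv, hvd⟩, hDd, ?_⟩
  · exact gball_mono (by linarith) (gball_trans (gball_trans hz hwz) (hCb hc))
  · intro c hc d hd p
    by_contra hlt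
    push Not at hlt
    have h2 : p.length ≤ 1 := by
      have : p.length < 2 := by exact_mod_cast hlt
      omega
    exact hsep c (hCS hc) ⟨d, hd, gball_symm ⟨p, by exact_mod_cast h2⟩⟩
  · rintro ⟨a, b, p, ⟨c, hc, hac⟩, hb, hpS, hpo⟩
    exact hsep b (Or.inr (clus_extend (hCS hc) hac ⟨p, fun v hv => ⟨hX (hpS v hv), hpo v hv⟩⟩)) hb

lemma sum_ncard_le {α : Type*} {E : Set α} (hE : E.Finite) (F : ℕ → Set α) (hF : ∀ j, F j ⊆ E)
    (hd : ∀ i j, i < j → Disjoint (F i) (F j)) (n : ℕ) :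
    ∑ j ∈ Finset.range n, (F j).ncard ≤ E.ncard := by
  have h : ∀ n, ∑ j ∈ Finset.range n, (F j).ncard = (⋃ j ∈ Finset.range n, F j).ncard := by
    intro n
    induction n with
    | zero => simp
    | succ n ih =>
      rw [Finset.sum_range_succ, ih, Finset.range_add_one, Finset.set_biUnion_insert,
        Set.union_comm, Set.ncard_union_eq ?_
          (hE.subset (Set.iUnion₂_subset fun i _ => hF i)) (hE.subset (hF n))]
      rw [Set.disjoint_iUnion₂_left]
      intro i hi
      exact hd i n (Finset.mem_range.1 hi)
  rw [h]
  exact Set.ncard_le_ncard (Set.iUnion₂_subset fun i _ => hF i) hE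

lemma iso_bound {G : SimpleGraph V} {di ci : ℝ} (hdi : 1 < di) (hci : 0 < ci)
    (hG : LocalIso G di ci) {x : V} {r a : ℝ} (hr : 1 ≤ r) (hfin : (gball G x r).Finite)
    (ha : 0 ≤ a) {U A B : Set V}
    (hA : A ⊆ U ∩ gball G x r) (hB : B ⊆ gball G x r \ U) (haA : a ≤ A.ncard)
    (haB : a ≤ B.ncard) :
    ci * a ^ ((di - 1) / di) ≤
      ({e : V × V | G.Adj e.1 e.2 ∧ e.1 ∈ gball G x r ∧ e.2 ∈ gball G x r ∧ e.1 ∈ U ∧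
        e.2 ∉ U}.ncard : ℝ) := by
  set X := gball G x r with hX
  have hb : 0 ≤ (di - 1) / di := div_nonneg (by linarith) (by linarith)
  have key : ∀ n : ℕ, a ≤ n → ci * a ^ ((di - 1) / di) ≤ ci * (n : ℝ) ^ ((di - 1) / di) :=
    fun n hn => mul_le_mul_of_nonneg_left (Real.rpow_le_rpow ha hn hb) hci.le
  have h1 : A.ncard ≤ (U ∩ X).ncard :=
    Set.ncard_le_ncard hA (hfin.subset Set.inter_subset_right)
  have h2 : B.ncard ≤ (X \ U).ncard :=
    Set.ncard_le_ncard hB (hfin.subset Set.sdiff_subset)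
  have h3 : (X ∩ U).ncard + (X \ U).ncard = X.ncard := Set.ncard_inter_add_ncard_sdiff_eq_ncard X U hfin
  rw [Set.inter_comm] at h3
  have h1' : (A.ncard : ℝ) ≤ (U ∩ X).ncard := by exact_mod_cast h1
  have h2' : (B.ncard : ℝ) ≤ (X \ U).ncard := by exact_mod_cast h2
  have h3' : ((U ∩ X).ncard : ℝ) + (X \ U).ncard = X.ncard := by exact_mod_cast h3
  by_cases hc : ((U ∩ X).ncard : ℝ) ≤ X.ncard / 2
  · refine (key _ (haA.trans h1')).trans ((hG x r hr _ Set.inter_subset_right hc).trans ?_)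
    apply le_of_eq
    congr 2
    ext ⟨e, f⟩
    simp only [relBoundary, Set.mem_ofPred_eq, Set.mem_inter_iff, ← hX]
    tauto
  · refine (key _ (haB.trans h2')).trans
      ((hG x r hr (X \ U) Set.sdiff_subset (by linarith)).trans ?_)
    apply le_of_eq
    congr 1
    rw [← Set.ncard_image_of_injective _ (Prod.swap_injective (α := V) (β := V))]
    congr 1
    ext ⟨e, f⟩
    simp only [relBoundary, Set.mem_ofPred_eq, Set.mem_sdiff, ← hX, Set.mem_image, Prod.exists,
      Prod.swap_prod_mk, Prod.mk.injEq]
    constructor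
    · rintro ⟨a, b, ⟨h1, h2, h3, h4⟩, rfl, rfl⟩
      exact ⟨h1.symm, h3, h2.1, by tauto, h2.2⟩
    · rintro ⟨h1, h2, h3, h4, h5⟩
      exact ⟨f, e, ⟨h1.symm, ⟨h3, h5⟩, h2, by tauto⟩, rfl, rfl⟩

lemma distGE_symm {G : SimpleGraph V} {u v : V} {t : ℝ} (h : distGE G u v t) :
    distGE G v u t := by
  intro p
  have := h p.reverse
  rwa [SimpleGraph.Walk.length_reverse] at this

lemma exists_separated (G : SimpleGraph V) {T : Set V} (hT : T.Finite) {s : ℝ} (hs : 0 ≤ s) :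
    ∃ Y : Finset V, (∀ y ∈ Y, y ∈ T) ∧ (∀ y ∈ Y, ∀ y' ∈ Y, y ≠ y' → distGE G y y' s) ∧
      ∀ t ∈ T, ∃ y ∈ Y, t ∈ gball G y s := by
  classical
  let P : Finset (Finset V) := hT.toFinset.powerset.filter
    fun Y => ∀ y ∈ Y, ∀ y' ∈ Y, y ≠ y' → distGE G y y' s
  obtain ⟨Y, hY⟩ := P.exists_maximal ⟨∅, by simp [P]⟩
  have hYP := hY.1
  simp only [P, Finset.mem_filter, Finset.mem_powerset] at hYP
  have hYT : ∀ y ∈ Y, y ∈ T := fun y hy => by simpa using hYP.1 hy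
  refine ⟨Y, hYT, hYP.2, fun t ht => ?_⟩
  by_contra hc
  push Not at hc
  have hd : ∀ y ∈ Y, distGE G y t s := by
    intro y hy
    by_contra h
    exact hc y hy (gball_of_not_distGE h)
  have htY : t ∉ Y := fun h => hc t h (gball_self G t hs)
  have hins : insert t Y ∈ P := by
    simp only [P, Finset.mem_filter, Finset.mem_powerset]
    refine ⟨Finset.insert_subset (by simpa using ht) hYP.1, ?_⟩
    intro y hy y' hy' hne
    rw [Finset.mem_insert] at hy hy'
    rcases hy with rfl | hy <;> rcases hy' with rfl | hy'
    · exact absurd rfl hne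
    · exact distGE_symm (hd _ hy')
    · exact hd _ hy
    · exact hYP.2 _ hy _ hy' hne
  exact htY (hY.2 hins (Finset.subset_insert t Y) (Finset.mem_insert_self t Y))

lemma edges_bound {G : SimpleGraph V} {du cu R : ℝ} (hR : 1 ≤ R) (hcu : 0 < cu)
    (hG : VolUpper G du cu) (Y : Finset V)
    {E : Set (V × V)} (hE : ∀ e ∈ E, G.Adj e.1 e.2 ∧ ∃ y ∈ Y, e.1 ∈ gball G y R) :
    E.Finite ∧ (E.ncard : ℝ) ≤ Y.card * (cu * R ^ du * cu) := by
  classical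
  let b : V → ℝ → Finset V := fun y r => if h : 1 ≤ r then (hG y r h).1.toFinset else ∅
  have hb : ∀ y r, 1 ≤ r → ∀ z, z ∈ b y r ↔ z ∈ gball G y r := by
    intro y r hr z
    simp [b, hr]
  have hbc : ∀ y r, 1 ≤ r → ((b y r).card : ℝ) ≤ cu * r ^ du := by
    intro y r hr
    have := (hG y r hr).2
    rw [Set.ncard_eq_toFinset_card _ (hG y r hr).1] at this
    simpa [b, hr] using this
  let F : Finset (V × V) := Y.biUnion fun y => (b y R).biUnion fun u => (b u 1).image fun v => (u, v)
  have hEF : E ⊆ F := by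
    intro e he
    obtain ⟨h1, y, hy, h2⟩ := hE e he
    simp only [F, Finset.coe_biUnion, Set.mem_iUnion, Finset.mem_coe, Finset.mem_image]
    exact ⟨y, hy, e.1, (hb y R hR _).2 h2, e.2, (hb _ 1 le_rfl _).2 (gball_adj h1), rfl⟩
  refine ⟨F.finite_toSet.subset hEF, ?_⟩
  have h1 : E.ncard ≤ F.card := by
    rw [← Set.ncard_coe_finset]
    exact Set.ncard_le_ncard hEF F.finite_toSet
  have h2 : ∀ y ∈ Y, ((((b y R).biUnion fun u => (b u 1).image fun v => (u, v)).card : ℕ) : ℝ)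
      ≤ cu * R ^ du * cu := by
    intro y _
    calc ((((b y R).biUnion fun u => (b u 1).image fun v => (u, v)).card : ℕ) : ℝ)
        ≤ ((∑ u ∈ b y R, ((b u 1).image fun v => (u, v)).card : ℕ) : ℝ) := by
          exact_mod_cast Finset.card_biUnion_le
      _ = ∑ u ∈ b y R, (((b u 1).image fun v => (u, v)).card : ℝ) := by push_cast; rfl
      _ ≤ ∑ u ∈ b y R, cu := by
          refine Finset.sum_le_sum fun u _ => ?_
          have h3 : (((b u 1).image fun v => (u, v)).card : ℝ) ≤ (b u 1).card := by
            exact_mod_cast Finset.card_image_le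
          have h4 := hbc u 1 le_rfl
          rw [Real.one_rpow, mul_one] at h4
          exact h3.trans h4
      _ = (b y R).card * cu := by rw [Finset.sum_const, nsmul_eq_mul]
      _ ≤ _ := mul_le_mul_of_nonneg_right (hbc y R hR) hcu.le
  calc (E.ncard : ℝ) ≤ F.card := by exact_mod_cast h1
    _ ≤ ((∑ y ∈ Y, ((b y R).biUnion fun u => (b u 1).image fun v => (u, v)).card : ℕ) : ℝ) := by
        exact_mod_cast Finset.card_biUnion_le
    _ = ∑ y ∈ Y, ((((b y R).biUnion fun u => (b u 1).image fun v => (u, v)).card : ℕ) : ℝ) := by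
        push_cast; rfl
    _ ≤ ∑ y ∈ Y, cu * R ^ du * cu := Finset.sum_le_sum h2
    _ = _ := by rw [Finset.sum_const, nsmul_eq_mul]

lemma exists_far_pieces {G : SimpleGraph V} {A B : Set V} {M : ℝ} (hM : 0 ≤ M)
    (hA : ConnSet G A) (hB : ConnSet G B) (hAd : diamGE G A (M / 100))
    (hBd : diamGE G B (M / 100)) :
    ∃ A' ⊆ A, ∃ B' ⊆ B, ConnSet G A' ∧ ConnSet G B' ∧ diamGE G A' (M / 800) ∧
      diamGE G B' (M / 800) ∧ setDistGE G A' B' (M / 400 - 2) := by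
  obtain ⟨a, ha, a', ha', haa⟩ := hAd
  obtain ⟨b₁, hb₁, b₂, hb₂, hbb⟩ := hBd
  obtain ⟨b, hb, hab⟩ : ∃ b ∈ B, distGE G a b (M / 200) := by
    rcases distGE_split hbb a with h | h
    · exact ⟨b₁, hb₁, distGE_mono h (by linarith)⟩
    · exact ⟨b₂, hb₂, distGE_mono h (by linarith)⟩
  obtain ⟨b', hb', hbb'⟩ : ∃ b' ∈ B, distGE G b b' (M / 800) := by
    rcases distGE_split hbb b with h | h
    · exact ⟨b₁, hb₁, distGE_mono h (by linarith)⟩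
    · exact ⟨b₂, hb₂, distGE_mono h (by linarith)⟩
  obtain ⟨A', hA', haA', hA'b, hA'c, u, hu, hau⟩ :=
    exists_piece (t := M / 800) (by linarith) (hA.walkIn ha ha') (distGE_mono haa (by linarith))
  obtain ⟨B', hB', hbB', hB'b, hB'c, v, hv, hbv⟩ :=
    exists_piece (t := M / 800) (by linarith) (hB.walkIn hb hb') hbb'
  refine ⟨A', hA', B', hB', hA'c, hB'c, ⟨a, haA', u, hu, hau⟩, ⟨b, hbB', v, hv, hbv⟩, ?_⟩
  intro c hc d hd p
  obtain ⟨q, hq⟩ := hA'b hc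
  obtain ⟨q', hq'⟩ := gball_symm (hB'b hd)
  have := hab ((q.append p).append q')
  rw [SimpleGraph.Walk.length_append, SimpleGraph.Walk.length_append] at this
  push_cast at this
  linarith

noncomputable def cc (di ci du cu : ℝ) : ℝ :=
  ci * (1 / 800) ^ ((di - 1) / di) / (200 * (cu * 4 ^ du * cu))

lemma cc_pos {di ci du cu : ℝ} (hci : 0 < ci) (hcu : 0 < cu) : 0 < cc di ci du cu := by
  unfold cc; positivity

lemma Lseq_ge {γ : ℝ} (hγ : 1 < γ) (k : ℕ) : 10000 ≤ Lseq γ k := by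
  induction k with
  | zero => exact le_rfl
  | succ k ih =>
    have h : Lseq γ (k + 1) = Lseq γ k ^ γ := rfl
    rw [h]
    have h2 : Lseq γ k ^ (1 : ℝ) ≤ Lseq γ k ^ γ :=
      Real.rpow_le_rpow_of_exponent_le (by linarith) hγ.le
    rw [Real.rpow_one] at h2
    linarith

lemma bad_edge {G : SimpleGraph V} {ω : V → Bool} {A B X : Set V} {y z z' a₁ a₂ b₁ b₂ : V}
    {L r : ℝ} (hL : 10000 ≤ L) (hA : ConnSet G A) (hB : ConnSet G B)
    (ha₁ : a₁ ∈ A) (ha₂ : a₂ ∈ A) (hda : distGE G a₁ a₂ (2 * L))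
    (hb₁ : b₁ ∈ B) (hb₂ : b₂ ∈ B) (hdb : distGE G b₁ b₂ (2 * L))
    (hsep : ∀ v ∈ clus G ω A X, v ∉ gnbhd G B 1)
    (hr : L / 50 ≤ r) (hr' : r + 1 ≤ L / 30) (hX : gball G y L ⊆ X)
    (hz : z ∈ gball G y (L / 6)) (hzz : G.Adj z z') (hreach : ∃ t, a₁ ∈ gball G z t)
    (hzA : z ∈ gnbhd G (clus G ω A X) r)
    (hz' : z' ∉ gnbhd G (clus G ω A X) r ∨ z' ∈ gnbhd G B r) : sep G ω y L := by
  obtain ⟨w, hw, hwz⟩ := hzA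
  rcases hz' with hz' | ⟨b, hb, hbz⟩
  · obtain ⟨u, hu, hud⟩ : ∃ u ∈ A, distGE G z' u (L / 100) := by
      rcases distGE_split hda z' with h | h
      · exact ⟨a₁, ha₁, distGE_mono h (by linarith)⟩
      · exact ⟨a₂, ha₂, distGE_mono h (by linarith)⟩
    have hwalk : WalkIn G Set.univ z' u := by
      obtain ⟨t, p, _⟩ := hreach
      have h1 : WalkIn G Set.univ z' a₁ := ⟨SimpleGraph.Walk.cons hzz.symm p, by simp⟩
      exact h1.trans ((hA.walkIn ha₁ hu).mono (Set.subset_univ _))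
    obtain ⟨D, -, hD1, hD2, hD3, v, hv, hvd⟩ := exists_piece (by linarith) hwalk hud
    refine sep_of hL hA ha₁ ha₂ hda hw (gball_symm hwz) (by linarith) hz hX hD3 ?_
      ⟨z', hD1, v, hv, hvd⟩ ?_
    · intro d hd
      exact gball_mono (by linarith) (gball_trans (gball_trans hz (gball_adj hzz)) (hD2 hd))
    · rintro c hc ⟨d, hd, hcd⟩
      exact hz' ⟨c, hc, gball_mono (by linarith) (gball_symm (gball_trans (hD2 hd) hcd))⟩
  · obtain ⟨u, hu, hud⟩ : ∃ u ∈ B, distGE G b u (L / 100) := by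
      rcases distGE_split hdb b with h | h
      · exact ⟨b₁, hb₁, distGE_mono h (by linarith)⟩
      · exact ⟨b₂, hb₂, distGE_mono h (by linarith)⟩
    obtain ⟨D, hD0, hD1, hD2, hD3, v, hv, hvd⟩ :=
      exists_piece (by linarith) (hB.walkIn hb hu) hud
    refine sep_of hL hA ha₁ ha₂ hda hw (gball_symm hwz) (by linarith) hz hX hD3 ?_
      ⟨b, hD1, v, hv, hvd⟩ ?_
    · intro d hd
      exact gball_mono (by linarith) (gball_trans (gball_trans (gball_trans hz (gball_adj hzz))
        (gball_symm hbz)) (hD2 hd))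
    · rintro c hc ⟨d, hd, hcd⟩
      exact hsep c hc ⟨d, hD0 hd, hcd⟩

lemma level_disjoint {G : SimpleGraph V} {S : Set V} {u v : V} {r s : ℝ} (hrs : r + 1 ≤ s)
    (h : G.Adj u v) (hu : u ∈ gnbhd G S r) (hv : v ∉ gnbhd G S s) : False :=
  hv (gnbhd_mono hrs (gnbhd_finset_level h hu))

lemma core {G : SimpleGraph V} {di ci du cu L M : ℝ} (hdi : 1 < di) (hci : 0 < ci) (hdu : 1 ≤ du)
    (hcu : 0 < cu) (hIso : LocalIso G di ci) (hVol : VolUpper G du cu) (hL : 10000 ≤ L)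
    (hLM : 2000 * L < M) {x : V} {ω : V → Bool} (hS : sep G ω x M) {K : Set V}
    (hK : K ⊆ gball G x (5 * M / 6)) (hKc : gball G x (4 * M / 6) ⊆ gnbhd G K (L / 6)) :
    ∃ Y : Finset V, (∀ y ∈ Y, y ∈ K) ∧ (∀ y ∈ Y, ∀ y' ∈ Y, y ≠ y' → distGE G y y' (3 * L)) ∧
      (∀ y ∈ Y, sep G ω y L) ∧
      cc di ci du cu * (M ^ ((di - 1) / di) * L ^ (1 - du)) ≤ Y.card := by
  obtain ⟨A₀, B₀, hA₀, hB₀, hA₀c, hB₀c, hAB₀, hA₀d, hB₀d, hno⟩ := hS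
  obtain ⟨A, hAA, B, hBB, hA, hB, ⟨a₁, ha₁, a₂, ha₂, hda⟩, ⟨b₁, hb₁, b₂, hb₂, hdb⟩, hAB⟩ :=
    exists_far_pieces (by linarith) hA₀c hB₀c hA₀d hB₀d
  set X := gball G x M with hXdef
  set W := gball G x (4 * M / 6) with hWdef
  have hWfin : W.Finite := (hVol x _ (by linarith)).1
  have hAW : A ⊆ W := fun a ha => gball_mono (by linarith) (hA₀ (hAA ha))
  have hBW : B ⊆ W := fun a ha => gball_mono (by linarith) (hB₀ (hBB ha))
  set R := clus G ω A X with hRdef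
  have hRB : ∀ v ∈ R, v ∉ gnbhd G B 1 := by
    rintro v (hv | ⟨a, ⟨a', ha', haa'⟩, p, hp⟩) ⟨b, hb, hbv⟩
    · obtain ⟨p, hp⟩ := gball_symm hbv
      have := hAB v hv b hb p
      linarith
    · exact hno ⟨a, v, p, ⟨a', hAA ha', haa'⟩, ⟨b, hBB hb, hbv⟩, fun u hu => (hp u hu).1,
        fun u hu => (hp u hu).2⟩
  have hAcard : M / 800 ≤ A.ncard := hA.le_ncard (hWfin.subset hAW) ha₁ ha₂ hda
  have hBcard : M / 800 ≤ B.ncard := hB.le_ncard (hWfin.subset hBW) hb₁ hb₂ hdb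
  -- bad points
  obtain ⟨Y, hYT, hYd, hYc⟩ := exists_separated G (T := {y | y ∈ K ∧ sep G ω y L})
    ((hVol x (5 * M / 6) (by linarith)).1.subset fun y hy => hK hy.1) (s := 3 * L) (by linarith)
  refine ⟨Y, fun y hy => (hYT y hy).1, hYd, fun y hy => (hYT y hy).2, ?_⟩
  set E : Set (V × V) := {e | G.Adj e.1 e.2 ∧ ∃ y ∈ Y, e.1 ∈ gball G y (4 * L)} with hE
  obtain ⟨hEfin, hEcard⟩ := edges_bound (R := 4 * L) (by linarith) hcu hVol Y (E := E)
    (fun e he => he)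
  let ρ : ℕ → ℝ := fun j => L / 50 + j
  let F₁ : ℕ → Set (V × V) := fun j => {e | e ∈ E ∧ e.1 ∈ gnbhd G R (ρ j) ∧ e.2 ∉ gnbhd G R (ρ j)}
  let F₂ : ℕ → Set (V × V) := fun j => {e | e ∈ E ∧ e.1 ∉ gnbhd G B (ρ j) ∧ e.2 ∈ gnbhd G B (ρ j)}
  have hρ : ∀ i j, i < j → ρ i + 1 ≤ ρ j := by
    intro i j hij
    have : ((i + 1 : ℕ) : ℝ) ≤ j := by exact_mod_cast hij
    push_cast at this
    simp only [ρ]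
    linarith
  set n := ⌈L / 100⌉₊ with hn
  have hn1 : L / 100 ≤ n := Nat.le_ceil _
  have hn2 : (n : ℝ) < L / 100 + 1 := Nat.ceil_lt_add_one (by linarith)
  have hs1 := sum_ncard_le hEfin F₁ (fun j e he => he.1) (fun i j hij => by
    rw [Set.disjoint_left]
    rintro e ⟨he, h1, -⟩ ⟨-, -, h2⟩
    exact level_disjoint (hρ i j hij) he.1 h1 h2) n
  have hs2 := sum_ncard_le hEfin F₂ (fun j e he => he.1) (fun i j hij => by
    rw [Set.disjoint_left]
    rintro e ⟨he, -, h1⟩ ⟨-, h2, -⟩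
    exact level_disjoint (hρ i j hij) he.1.symm h1 h2) n
  have hlev : ∀ j ∈ Finset.range n, ci * (M / 800) ^ ((di - 1) / di) ≤
      ((F₁ j).ncard : ℝ) + (F₂ j).ncard := by
    intro j hj
    have hj' : (j : ℝ) < n := by exact_mod_cast Finset.mem_range.1 hj
    have hj0 : (0 : ℝ) ≤ j := Nat.cast_nonneg j
    have hr1 : L / 50 ≤ ρ j := by simp only [ρ]; linarith
    have hr2 : ρ j + 1 ≤ L / 30 := by simp only [ρ]; linarith
    have h := iso_bound hdi hci hIso (x := x) (r := 4 * M / 6) (by linarith) hWfin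
      (a := M / 800) (by linarith) (U := gnbhd G R (ρ j) \ gnbhd G B (ρ j)) (A := A) (B := B)
      (fun a ha => ⟨⟨⟨a, Or.inl ha, gball_self G a (by linarith)⟩, ?_⟩, hAW ha⟩)
      (fun b hb => ⟨hBW hb, fun h => h.2 ⟨b, hb, gball_self G b (by linarith)⟩⟩) hAcard hBcard
    · refine h.trans ?_
      have hsub : {e : V × V | G.Adj e.1 e.2 ∧ e.1 ∈ gball G x (4 * M / 6) ∧
          e.2 ∈ gball G x (4 * M / 6) ∧ e.1 ∈ gnbhd G R (ρ j) \ gnbhd G B (ρ j) ∧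
          e.2 ∉ gnbhd G R (ρ j) \ gnbhd G B (ρ j)} ⊆ F₁ j ∪ F₂ j := by
        rintro ⟨z, z'⟩ ⟨hadj, hzW, hzW', ⟨hzR, hzB⟩, hz'⟩
        have hz'' : z' ∉ gnbhd G R (ρ j) ∨ z' ∈ gnbhd G B (ρ j) := by
          by_contra hc
          push Not at hc
          exact hz' hc
        obtain ⟨y, hyK, hzy⟩ := hKc hzW
        have hbad : sep G ω y L := by
          refine bad_edge hL hA hB ha₁ ha₂ (distGE_mono hda (by linarith)) hb₁ hb₂
            (distGE_mono hdb (by linarith)) hRB hr1 hr2 ?_ hzy hadj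
            ⟨_, gball_trans (gball_symm hzW) (hAW ha₁)⟩ hzR hz''
          intro v hv
          exact gball_mono (by linarith) (gball_trans (hK hyK) hv)
        obtain ⟨y', hy', hyy'⟩ := hYc y ⟨hyK, hbad⟩
        have he : (z, z') ∈ E := ⟨hadj, y', hy', gball_mono (by linarith) (gball_trans hyy' hzy)⟩
        rcases hz'' with h | h
        · exact Or.inl ⟨he, hzR, h⟩
        · exact Or.inr ⟨he, hzB, h⟩
      have h1 := Set.ncard_le_ncard hsub (hEfin.subset (Set.union_subset (fun e he => he.1)
        fun e he => he.1))
      have h2 := Set.ncard_union_le (F₁ j) (F₂ j)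
      exact_mod_cast h1.trans h2
    · rintro ⟨b, hb, hba⟩
      obtain ⟨p, hp⟩ := gball_symm hba
      have := hAB a ha b hb p
      linarith
  have hsum := Finset.sum_le_sum hlev
  rw [Finset.sum_const, Finset.card_range, nsmul_eq_mul, Finset.sum_add_distrib] at hsum
  have hs1' : (∑ j ∈ Finset.range n, ((F₁ j).ncard : ℝ)) ≤ E.ncard := by exact_mod_cast hs1
  have hs2' : (∑ j ∈ Finset.range n, ((F₂ j).ncard : ℝ)) ≤ E.ncard := by exact_mod_cast hs2
  have hL0 : 0 < L := by linarith
  have hM0 : 0 < M := by linarith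
  have hpos : 0 ≤ ci * (M / 800) ^ ((di - 1) / di) := by positivity
  have h1 : L / 100 * (ci * (M / 800) ^ ((di - 1) / di)) ≤
      2 * (Y.card * (cu * (4 * L) ^ du * cu)) := by
    have := mul_le_mul_of_nonneg_right hn1 hpos
    linarith
  have e1 : (M / 800) ^ ((di - 1) / di) = M ^ ((di - 1) / di) * (1 / 800) ^ ((di - 1) / di) := by
    rw [← Real.mul_rpow hM0.le (by norm_num)]
    congr 1
    ring
  have e2 : (4 * L) ^ du = 4 ^ du * L ^ du := Real.mul_rpow (by norm_num) hL0.le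
  have e3 : L ^ (1 - du) = L / L ^ du := by rw [Real.rpow_sub hL0, Real.rpow_one]
  rw [e1, e2] at h1
  rw [e3, cc]
  have p1 : 0 < L ^ du := by positivity
  have p2 : (0 : ℝ) < 4 ^ du := by positivity
  generalize L ^ du = q at *
  generalize (4 : ℝ) ^ du = f at *
  generalize M ^ ((di - 1) / di) = m at *
  generalize (1 / 800 : ℝ) ^ ((di - 1) / di) = g at *
  have e4 : ci * g / (200 * (cu * f * cu)) * (m * (L / q)) =
      ci * g * m * L / (200 * (cu * f * cu) * q) := by
    field_simp
  rw [e4]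
  rw [div_le_iff₀ (by positivity)]
  linarith

/-- a separation event at scale `k+1` induces
`N = ⌊c₄ L_k^{γ(dᵢ-1)/dᵢ - (dᵤ-1)}⌋` separation events at scale `k`, centered at points
of `K` which are mutually at distance at least `3 L_k`. -/
theorem statement9 :
    ∀ (di ci du cu : ℝ), 1 < di → 0 < ci → 1 ≤ du → 0 < cu →
    ∃ c4 : ℝ, 0 < c4 ∧
      ∀ (V : Type u) (G : SimpleGraph V), LocalIso G di ci → VolUpper G du cu →
        ∀ (γ : ℝ), 1 < γ → ∀ (x : V) (k : ℕ), 1 ≤ k →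
          2000 * Lseq γ k < Lseq γ (k + 1) →
          ∀ ω : V → Bool, sep G ω x (Lseq γ (k + 1)) →
          ∀ K : Set V, K ⊆ gball G x (5 * Lseq γ (k + 1) / 6) →
            gball G x (4 * Lseq γ (k + 1) / 6) ⊆ gnbhd G K (Lseq γ k / 6) →
            ∃ y : Fin ⌊c4 * Lseq γ k ^ (γ * ((di - 1) / di) - (du - 1))⌋₊ → V,
              (∀ j, y j ∈ K) ∧
              (∀ j j', j ≠ j' → distGE G (y j) (y j') (3 * Lseq γ k)) ∧
              (∀ j, sep G ω (y j) (Lseq γ k)) := by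
  intro di ci du cu hdi hci hdu hcu
  refine ⟨cc di ci du cu, cc_pos hci hcu, ?_⟩
  intro V G hIso hVol γ hγ x k hk hLk ω hsep K hK hKc
  have hL := Lseq_ge hγ k
  obtain ⟨Y, hY1, hY2, hY3, hY4⟩ := core hdi hci hdu hcu hIso hVol hL hLk hsep hK hKc
  have hLpos : 0 < Lseq γ k := by linarith
  have hfl : ⌊cc di ci du cu * Lseq γ k ^ (γ * ((di - 1) / di) - (du - 1))⌋₊ ≤ Y.card := by
    apply Nat.floor_le_of_le
    refine le_trans (le_of_eq ?_) hY4
    have h1 : Lseq γ (k + 1) = Lseq γ k ^ γ := rfl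
    rw [h1, ← Real.rpow_mul hLpos.le, ← Real.rpow_add hLpos]
    congr 2
    ring
  let f := (Fin.castLEEmb hfl).trans Y.equivFin.symm.toEmbedding
  refine ⟨fun j => (f j).1, fun j => hY1 _ (f j).2, fun j j' hne => ?_, fun j => hY3 _ (f j).2⟩
  refine hY2 _ (f j).2 _ (f j').2 fun h => hne ?_
  exact f.injective (Subtype.ext h)
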